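/- arXiv:2603.00673 — 2 statements merged into one kernel-verified Lean document; each statement's English description precedes it below -/
import Mathlib

section
/- For nonnegative integers r and s, the series C_{r,s} := ∑_{n=0}^{∞} ζ(2n)/((2n+2r+1)(2n+2r+2)···(2n+2r+2s+2)·2^{2n}) equals -(1/(2·(2s+1)!)) · [∑_{k=1}^{r+s+1} (-1)^{k+1}(4^k-1)ζ(2k+1)(2k)!/(2π)^{2k} · C(2r+1, 2k-2s-1) + ∑_{k=1}^{r+s+1} (2k)!(-1)^{k+1} ζ(2k+1)/π^{2k} · C(2s+1, 2k-2r-1)]. -/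
/-- Binomial coefficient `C(n, k)` with integer lower index, zero when `k < 0`. -/
def chooseInt (n : ℕ) (k : ℤ) : ℤ := if 0 ≤ k then (n.choose k.toNat : ℤ) else 0

open Complex Polynomial

theorem hasSum_riemannZeta_two_mul_mul_pow {x : ℂ} (hx0 : x ≠ 0) (hx : ‖x‖ < 1) :
    HasSum (fun n : ℕ ↦ riemannZeta (2 * n) * x ^ (2 * n))
      (-(Real.pi * x / 2) * cot (Real.pi * x)) := by
  have hmem : x ∈ integerComplement := by
    rintro ⟨n, rfl⟩
    have hn : n ≠ 0 := by rintro rfl; simp at hx0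
    rw [Complex.norm_intCast] at hx
    exact absurd (Int.one_le_abs hn) (by exact_mod_cast not_le.2 hx)
  set F : ℕ → ℕ → ℂ := fun m n ↦ (x ^ 2 / (n + 1 : ℂ) ^ 2) ^ (m + 1) with hF
  have hnorm (n : ℕ) : ‖(n + 1 : ℂ)‖ = n + 1 := by
    exact_mod_cast Complex.norm_natCast (n + 1)
  have hx2 : ‖x‖ ^ 2 < 1 := pow_lt_one₀ (norm_nonneg _) hx two_ne_zero
  have hsum : Summable (Function.uncurry F) := by
    have h1 : Summable fun m : ℕ ↦ (‖x‖ ^ 2) ^ (m + 1) :=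
      (summable_nat_add_iff 1).2 (summable_geometric_of_lt_one (by positivity) hx2)
    have h2 : Summable fun n : ℕ ↦ 1 / (n + 1 : ℝ) ^ 2 := by
      exact_mod_cast (summable_nat_add_iff 1).2 (Real.summable_one_div_nat_pow.2 one_lt_two)
    refine Summable.of_norm_bounded (h1.mul_of_nonneg h2 (fun _ ↦ by positivity)
      (fun _ ↦ by positivity)) ?_
    rintro ⟨m, n⟩
    simp only [Function.uncurry, hF, norm_pow, norm_div, hnorm, div_pow, ← pow_mul]
    rw [div_eq_mul_one_div]
    gcongr
    · linarith [n.cast_nonneg (α := ℝ)]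
    · omega
  have hcol (n : ℕ) : HasSum (fun m ↦ F m n)
      (-(x / 2) * (1 / (x - (n + 1)) + 1 / (x + (n + 1)))) := by
    have hn : (n + 1 : ℂ) ≠ 0 := by exact_mod_cast n.succ_ne_zero
    have hq : ‖x ^ 2 / (n + 1 : ℂ) ^ 2‖ < 1 := by
      rw [norm_div, norm_pow, norm_pow, hnorm, div_lt_one (by positivity)]
      nlinarith [n.cast_nonneg (α := ℝ)]
    have h := (hasSum_geometric_of_norm_lt_one hq).mul_left (x ^ 2 / (n + 1 : ℂ) ^ 2)
    convert! h using 1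
    · ext m; simp only [hF]; ring
    · have ha : x + (n + 1) ≠ 0 := by
        simpa using Complex.integerComplement_add_ne_zero hmem (n + 1)
      have hb : x - (n + 1) ≠ 0 := by
        simpa [sub_eq_add_neg] using Complex.integerComplement_add_ne_zero hmem (-(n + 1))
      have hc : 1 - x ^ 2 / (n + 1 : ℂ) ^ 2 ≠ 0 := by
        rw [one_sub_div (pow_ne_zero _ hn)]
        refine div_ne_zero ?_ (pow_ne_zero _ hn)
        rw [show (n + 1 : ℂ) ^ 2 - x ^ 2 = -((x + (n + 1)) * (x - (n + 1))) by ring]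
        exact neg_ne_zero.2 (mul_ne_zero ha hb)
      have hd : (n + 1 : ℂ) ^ 2 - x ^ 2 ≠ 0 := by
        intro h0
        apply hc
        rw [one_sub_div (pow_ne_zero _ hn), h0, zero_div]
      field_simp
      ring
  have hrow (m : ℕ) : ∑' n, F m n = riemannZeta (2 * (m + 1 : ℕ)) * x ^ (2 * (m + 1)) := by
    have hz := zeta_eq_tsum_one_div_nat_add_one_cpow (s := 2 * (m + 1 : ℕ))
      (by simp; linarith [m.cast_nonneg (α := ℝ)])
    rw [hz, ← tsum_mul_right]
    refine tsum_congr fun n ↦ ?_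
    rw [show (2 * (m + 1 : ℕ) : ℂ) = ((2 * (m + 1) : ℕ) : ℂ) by push_cast; ring, cpow_natCast]
    simp only [hF, div_pow, ← pow_mul]
    ring
  have htail : HasSum (fun m : ℕ ↦ riemannZeta (2 * (m + 1 : ℕ)) * x ^ (2 * (m + 1)))
      (-(x / 2) * (Real.pi * cot (Real.pi * x) - 1 / x)) := by
    have h := (hsum.prod_factor · |>.hasSum) |> hsum.hasSum.prod_fiberwise
    simp only [Function.uncurry] at h
    simp_rw [hrow] at h
    convert! h using 1
    change _ = ∑' b, Function.uncurry F b
    rw [hsum.tsum_prod]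
    change _ = ∑' b, ∑' c, F b c
    rw [← Summable.tsum_comm hsum, cot_series_rep' hmem, ← tsum_mul_left]
    exact tsum_congr fun n ↦ (hcol n).tsum_eq.symm
  rw [← hasSum_nat_add_iff' 1]
  convert! htail using 1
  simp [riemannZeta_zero]
  field_simp
  ring

theorem integral_pow_mul_one_sub_pow (m l : ℕ) :
    ∫ t in (0 : ℝ)..1, (t : ℂ) ^ m * (1 - (t : ℂ)) ^ l =
      (l.factorial : ℂ) / ∏ i ∈ Finset.Icc (m + 1) (m + l + 1), (i : ℂ) := by
  have h := betaIntegral_eval_nat_add_one_right (u := m + 1)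
    (by simp; linarith [m.cast_nonneg (α := ℝ)]) l
  simp only [betaIntegral, add_sub_cancel_right, cpow_natCast] at h
  rw [h, ← Finset.Ico_add_one_right_eq_Icc, Finset.prod_Ico_eq_prod_range]
  congr 1
  rw [show m + l + 1 + 1 - (m + 1) = l + 1 by omega]
  exact Finset.prod_congr rfl fun i _ ↦ by push_cast; ring

theorem hasSum_one_div_nat_pow_riemannZeta {p : ℕ} (hp : 1 < p) :
    HasSum (fun n : ℕ ↦ 1 / (n : ℂ) ^ p) (riemannZeta p) := by
  rw [zeta_nat_eq_tsum_of_gt_one hp]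
  refine Summable.hasSum ?_
  simpa using (Complex.summable_one_div_nat_cpow (p := p)).2 (by simpa using hp)

theorem hasSum_neg_one_pow_div_pow {p : ℕ} (hp : 1 < p) :
    HasSum (fun k : ℕ ↦ (-1 : ℂ) ^ (k + 1) / (k + 1 : ℂ) ^ p)
      (-(1 - 2 / 2 ^ p) * riemannZeta p) := by
  have h1 := hasSum_one_div_nat_pow_riemannZeta hp
  have h2 : HasSum (fun n : ℕ ↦ (1 + (-1) ^ n) / (n : ℂ) ^ p) (2 / 2 ^ p * riemannZeta p) := by
    have hinj : Function.Injective fun n : ℕ ↦ 2 * n := fun a b h ↦ by simpa using h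
    rw [← hinj.hasSum_iff]
    · convert! h1.mul_left (2 / 2 ^ p) using 2 with n
      simp [mul_pow]
      ring
    · intro n hn
      have : Odd n := by
        rw [← Nat.not_even_iff_odd]
        rintro ⟨k, rfl⟩
        exact hn ⟨k, by ring⟩
      simp [this.neg_one_pow]
  have h3 := h2.sub h1
  rw [← hasSum_nat_add_iff' 1] at h3
  convert! h3 using 1
  · ext k
    push_cast
    ring
  · simp [show p ≠ 0 by omega]
    ring

theorem mul_integral_eval_mul_sin (P : ℂ[X]) {a : ℂ} (ha : a ≠ 0) (hsin : sin a = 0) :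
    a * ∫ t in (0 : ℝ)..1, P.eval (t : ℂ) * sin (a * t) =
      P.eval 0 - P.eval 1 * cos a -
        (a * ∫ t in (0 : ℝ)..1, (derivative (derivative P)).eval (t : ℂ) * sin (a * t)) / a ^ 2 := by
  have hderiv (t : ℝ) : HasDerivAt
      (fun t : ℝ ↦ -(P.eval (t : ℂ) * cos (a * t)) + (derivative P).eval (t : ℂ) * sin (a * t) / a)
      (a * (P.eval (t : ℂ) * sin (a * t)) +
        (derivative (derivative P)).eval (t : ℂ) * sin (a * t) / a) t := by
    have hl : HasDerivAt (fun z : ℂ ↦ a * z) a t := by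
      simpa using (hasDerivAt_id (t : ℂ)).const_mul a
    have h := ((P.hasDerivAt (t : ℂ)).mul hl.ccos).neg.add
      ((((derivative P).hasDerivAt (t : ℂ)).mul hl.csin).div_const a)
    refine h.comp_ofReal.congr_deriv ?_
    field_simp
    ring
  have hcont (Q : ℂ[X]) : Continuous fun t : ℝ ↦ Q.eval (t : ℂ) * sin (a * t) :=
    (Q.continuous.comp continuous_ofReal).mul (by fun_prop)
  have hFTC := intervalIntegral.integral_eq_sub_of_hasDerivAt (a := 0) (b := 1)
    (fun t _ ↦ hderiv t) (Continuous.intervalIntegrable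
      (((hcont P).const_mul a).add ((hcont _).div_const a)) 0 1)
  rw [intervalIntegral.integral_add (((hcont P).const_mul a).intervalIntegrable 0 1)
    (((hcont _).div_const a).intervalIntegrable 0 1), intervalIntegral.integral_const_mul,
    intervalIntegral.integral_div] at hFTC
  simp only [ofReal_one, ofReal_zero, mul_one, mul_zero, hsin, sin_zero, cos_zero] at hFTC
  rw [eq_sub_of_add_eq hFTC]
  field_simp
  ring

theorem mul_integral_eval_mul_sin_eq_sum (P : ℂ[X]) {a : ℂ} (ha : a ≠ 0) (hsin : sin a = 0)
    {m : ℕ} (hm : P.natDegree < 2 * m) :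
    a * ∫ t in (0 : ℝ)..1, P.eval (t : ℂ) * sin (a * t) =
      ∑ j ∈ Finset.range m, (-1) ^ j / a ^ (2 * j) *
        ((derivative^[2 * j] P).eval 0 - (derivative^[2 * j] P).eval 1 * cos a) := by
  have key (m : ℕ) : a * ∫ t in (0 : ℝ)..1, P.eval (t : ℂ) * sin (a * t) =
      ∑ j ∈ Finset.range m, (-1) ^ j / a ^ (2 * j) *
        ((derivative^[2 * j] P).eval 0 - (derivative^[2 * j] P).eval 1 * cos a) +
      (-1) ^ m / a ^ (2 * m) *
        (a * ∫ t in (0 : ℝ)..1, (derivative^[2 * m] P).eval (t : ℂ) * sin (a * t)) := by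
    induction m with
    | zero => simp
    | succ m ih =>
      rw [ih, Finset.sum_range_succ, mul_integral_eval_mul_sin _ ha hsin,
        show 2 * (m + 1) = 2 * m + 1 + 1 by ring, Function.iterate_succ_apply',
        Function.iterate_succ_apply', add_assoc]
      congr 1
      field_simp
      ring
  rw [key m, iterate_derivative_eq_zero hm]
  simp

open Filter Topology MeasureTheory in
theorem tendsto_integral_mul_cos {g : ℝ → ℂ} (hg : ContinuousOn g (Set.Icc 0 1)) :
    Tendsto (fun N : ℕ ↦ ∫ t in (0 : ℝ)..1, g t * cos ((N + 1 / 2) * Real.pi * t))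
      atTop (𝓝 0) := by
  set G : ℝ → ℂ := (Set.Ioc 0 1).indicator g with hG
  have hint : Integrable G := by
    rw [hG, integrable_indicator_iff measurableSet_Ioc]
    exact (hg.integrableOn_Icc).mono_set Set.Ioc_subset_Icc_self
  have hRL := Real.tendsto_integral_exp_smul_cocompact G
  have hw : Tendsto (fun N : ℕ ↦ ((N : ℝ) + 1 / 2) / 2) atTop atTop :=
    (tendsto_atTop_add_const_right _ _ tendsto_natCast_atTop_atTop).atTop_div_const two_pos
  have h1 := hRL.comp ((hw.mono_right atTop_le_cocompact))
  have h2 := hRL.comp ((tendsto_neg_atTop_atBot.comp hw).mono_right atBot_le_cocompact)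
  have h3 := (h1.add h2).div_const 2
  rw [add_zero, zero_div] at h3
  refine h3.congr fun N ↦ ?_
  have hi (w : ℝ) : Integrable fun v : ℝ ↦ Real.fourierChar (-(v * w)) • G v := by
    simpa [mul_comm] using (Real.fourierIntegral_convergent_iff w).2 hint
  simp only [Function.comp]
  rw [← integral_add (hi _) (hi _), ← integral_div,
    intervalIntegral.integral_of_le zero_le_one, ← integral_indicator measurableSet_Ioc]
  congr 1
  ext v
  by_cases hv : v ∈ Set.Ioc (0 : ℝ) 1
  · simp only [hG, Set.indicator_of_mem hv, Circle.smul_def, Real.fourierChar_apply, smul_eq_mul,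
      Complex.cos]
    push_cast
    ring_nf
  · simp [hG, Set.indicator_of_notMem hv]

theorem two_mul_sin_half_mul_sum_sin (x : ℝ) (N : ℕ) :
    2 * Real.sin (x / 2) * ∑ k ∈ Finset.range N, Real.sin ((k + 1) * x) =
      Real.cos (x / 2) - Real.cos ((N + 1 / 2) * x) := by
  induction N with
  | zero => simp; ring_nf
  | succ N ih =>
    rw [Finset.sum_range_succ, mul_add, ih, Real.two_mul_sin_mul_sin]
    rw [← Real.cos_neg (x / 2 - _)]
    push_cast
    ring_nf

theorem sinc_pi_mul_div_two_ne_zero {t : ℝ} (ht : t ∈ Set.Icc (0 : ℝ) 1) :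
    Real.sinc (Real.pi * t / 2) ≠ 0 := by
  rcases ht.1.eq_or_lt with rfl | h0
  · simp
  · have hpos : 0 < Real.pi * t / 2 := by positivity
    rw [Real.sinc_of_ne_zero hpos.ne']
    refine (div_pos (Real.sin_pos_of_pos_of_lt_pi hpos ?_) hpos).ne'
    nlinarith [Real.pi_pos, ht.2]

theorem mul_sum_sin_eq_div_sinc {t : ℝ} (ht : t ∈ Set.Icc (0 : ℝ) 1) (N : ℕ) :
    t * (Real.pi * ∑ k ∈ Finset.range N, Real.sin ((k + 1) * (Real.pi * t))) =
      (Real.cos (Real.pi * t / 2) - Real.cos ((N + 1 / 2) * (Real.pi * t))) /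
        Real.sinc (Real.pi * t / 2) := by
  rw [← two_mul_sin_half_mul_sum_sin, eq_div_iff (sinc_pi_mul_div_two_ne_zero ht)]
  rcases ht.1.eq_or_lt with rfl | h0
  · simp
  · have hpos : 0 < Real.pi * t / 2 := by positivity
    rw [Real.sinc_of_ne_zero hpos.ne']
    field_simp

theorem eval_zero_iterate_derivative {R : Type*} [CommRing R] (P : R[X]) (n : ℕ) :
    (derivative^[n] P).eval 0 = n.factorial * P.coeff n := by
  rw [← coeff_zero_eq_eval_zero, coeff_iterate_derivative]
  simp [Nat.descFactorial_self]

theorem eval_one_iterate_derivative_two_mul {R : Type*} [CommRing R] (P : R[X]) (j : ℕ) :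
    (derivative^[2 * j] P).eval 1 = (derivative^[2 * j] (P.comp (1 - X))).eval 0 := by
  simp [iterate_derivative_comp_one_sub_X, eval_comp]

theorem coeff_X_pow_mul_one_sub_X_pow {R : Type*} [CommRing R] (r b j : ℕ) :
    (X ^ (2 * r + 1) * (1 - X) ^ b : R[X]).coeff (2 * j) =
      -(if 2 * r + 1 ≤ 2 * j then (b.choose (2 * j - (2 * r + 1)) : R) else 0) := by
  rw [coeff_X_pow_mul']
  split_ifs with h
  · have : ((1 - X) ^ b : R[X]) = ((1 + X) ^ b : R[X]).comp (C (-1) * X) := by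
      simp [sub_eq_add_neg]
    have hodd : Odd (2 * j - (2 * r + 1)) := ⟨j - r - 1, by omega⟩
    rw [this, comp_C_mul_X_coeff, coeff_one_add_X_pow, hodd.neg_one_pow]
    simp
  · simp

theorem coeff_X_pow_mul_one_sub_X_pow_eq_neg_chooseInt (r b j : ℕ) :
    (X ^ (2 * r + 1) * (1 - X) ^ b : ℂ[X]).coeff (2 * j) =
      -(chooseInt b (2 * j - 2 * r - 1) : ℂ) := by
  rw [coeff_X_pow_mul_one_sub_X_pow, chooseInt]
  by_cases h : 2 * r + 1 ≤ 2 * j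
  · rw [if_pos h, if_pos (by omega), show ((2 * j - 2 * r - 1 : ℤ)).toNat = 2 * j - (2 * r + 1) by
      omega]
    simp
  · rw [if_neg h, if_neg (by omega)]
    simp

theorem tsum_riemannZeta_div_eq_integral (r s : ℕ) :
    ∑' n : ℕ, riemannZeta (2 * n) /
        ((∏ i ∈ Finset.Icc (2 * n + 2 * r + 1) (2 * n + 2 * r + 2 * s + 2), (i : ℂ))
          * 2 ^ (2 * n)) =
      -(1 / (2 * (Nat.factorial (2 * s + 1) : ℂ))) *
        ∫ t in (0 : ℝ)..1, (t : ℂ) ^ (2 * r) * (1 - (t : ℂ)) ^ (2 * s + 1) *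
          ((Real.cos (Real.pi * t / 2) / Real.sinc (Real.pi * t / 2) : ℝ) : ℂ) := by
  have hfac : ((2 * s + 1).factorial : ℂ) ≠ 0 := by exact_mod_cast Nat.factorial_ne_zero _
  have hb : ‖(1 / 2 : ℂ)‖ < 1 := by norm_num
  have hsum := (hasSum_riemannZeta_two_mul_mul_pow (x := 1 / 2) (by norm_num) hb).summable.norm
  have hmain := intervalIntegral.hasSum_integral_of_dominated_convergence
    (μ := MeasureTheory.volume) (a := 0) (b := 1)
    (F := fun (n : ℕ) (t : ℝ) ↦ riemannZeta (2 * n) * (t / 2 : ℂ) ^ (2 * n) *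
      ((t : ℂ) ^ (2 * r) * (1 - (t : ℂ)) ^ (2 * s + 1)))
    (f := fun t : ℝ ↦ -(1 / 2) * ((t : ℂ) ^ (2 * r) * (1 - (t : ℂ)) ^ (2 * s + 1) *
      ((Real.cos (Real.pi * t / 2) / Real.sinc (Real.pi * t / 2) : ℝ) : ℂ)))
    (fun n _ ↦ ‖riemannZeta (2 * n) * (1 / 2) ^ (2 * n)‖)
    (fun n ↦ (Continuous.aestronglyMeasurable (by fun_prop)))
    (fun n ↦ .of_forall fun t ht ↦ ?_) (.of_forall fun t _ ↦ hsum) (by simp)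
    (.of_forall fun t ht ↦ ?_)
  · rw [intervalIntegral.integral_const_mul] at hmain
    have h := (hmain.div_const ((2 * s + 1).factorial : ℂ)).tsum_eq
    refine (tsum_congr fun n ↦ ?_).trans (h.trans ?_)
    · have hint := integral_pow_mul_one_sub_pow (2 * n + 2 * r) (2 * s + 1)
      have hcongr : ∀ t : ℝ, riemannZeta (2 * n) * (t / 2 : ℂ) ^ (2 * n) *
          ((t : ℂ) ^ (2 * r) * (1 - (t : ℂ)) ^ (2 * s + 1)) =
          riemannZeta (2 * n) / 2 ^ (2 * n) *
            ((t : ℂ) ^ (2 * n + 2 * r) * (1 - (t : ℂ)) ^ (2 * s + 1)) := by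
        intro t
        rw [div_pow, pow_add]
        ring
      simp_rw [hcongr]
      rw [intervalIntegral.integral_const_mul, hint,
        show 2 * n + 2 * r + (2 * s + 1) + 1 = 2 * n + 2 * r + 2 * s + 2 by ring]
      field_simp
    · field_simp
  · rw [Set.uIoc_of_le zero_le_one] at ht
    have hw : ‖(t : ℂ) ^ (2 * r) * (1 - (t : ℂ)) ^ (2 * s + 1)‖ ≤ 1 := by
      have h1 : ‖(1 - t : ℂ)‖ = 1 - t := by
        rw [← ofReal_one, ← ofReal_sub, norm_real, Real.norm_of_nonneg (by linarith [ht.2])]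
      rw [norm_mul, norm_pow, norm_pow, h1, norm_real, Real.norm_of_nonneg ht.1.le]
      exact mul_le_one₀ (pow_le_one₀ ht.1.le ht.2) (pow_nonneg (by linarith [ht.2]) _)
        (pow_le_one₀ (by linarith [ht.2]) (by linarith [ht.1]))
    rw [norm_mul]
    refine (mul_le_of_le_one_right (norm_nonneg _) hw).trans ?_
    rw [norm_mul, norm_mul, norm_pow, norm_pow]
    gcongr
    simp only [norm_div, norm_real, Real.norm_of_nonneg ht.1.le, norm_one]
    gcongr
    exact ht.2
  · rw [Set.uIoc_of_le zero_le_one] at ht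
    have ht0 : (t : ℂ) ≠ 0 := by exact_mod_cast ht.1.ne'
    have hn : ‖(t / 2 : ℂ)‖ < 1 := by
      simp only [norm_div, norm_real, Real.norm_of_nonneg ht.1.le, Complex.norm_ofNat]
      linarith [ht.2]
    have h := (hasSum_riemannZeta_two_mul_mul_pow (div_ne_zero ht0 two_ne_zero) hn).mul_right
      ((t : ℂ) ^ (2 * r) * (1 - (t : ℂ)) ^ (2 * s + 1))
    convert! h using 1
    have hpt : Real.pi * t / 2 ≠ 0 := by have := ht.1; positivity
    rw [Real.sinc_of_ne_zero hpt, cot, show (Real.pi * (t / 2) : ℂ) = ((Real.pi * t / 2 : ℝ) : ℂ) by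
      push_cast; ring, ← ofReal_cos, ← ofReal_sin]
    have hs : (Real.sin (Real.pi * t / 2) : ℂ) ≠ 0 := by
      refine ofReal_ne_zero.2 (Real.sin_pos_of_pos_of_lt_pi ?_ ?_).ne'
      · have := ht.1; positivity
      · nlinarith [Real.pi_pos, ht.2]
    push_cast
    push_cast at hs
    field_simp

open Filter Topology in
theorem tendsto_sum_integral_mul_sin (r s : ℕ) :
    Tendsto (fun N ↦ ∑ k ∈ Finset.range N, Real.pi * ∫ t in (0 : ℝ)..1,
        (X ^ (2 * r + 1) * (1 - X) ^ (2 * s + 1) : ℂ[X]).eval (t : ℂ) *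
          sin (((k + 1 : ℕ) * Real.pi : ℂ) * t)) atTop
      (𝓝 (∫ t in (0 : ℝ)..1, (t : ℂ) ^ (2 * r) * (1 - (t : ℂ)) ^ (2 * s + 1) *
          ((Real.cos (Real.pi * t / 2) / Real.sinc (Real.pi * t / 2) : ℝ) : ℂ))) := by
  have hsinc : ContinuousOn (fun t : ℝ ↦ ((Real.sinc (Real.pi * t / 2) : ℝ) : ℂ))
      (Set.Icc 0 1) :=
    (continuous_ofReal.comp (Real.continuous_sinc.comp (by fun_prop))).continuousOn
  have hne : ∀ t ∈ Set.Icc (0 : ℝ) 1, ((Real.sinc (Real.pi * t / 2) : ℝ) : ℂ) ≠ 0 :=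
    fun t ht ↦ ofReal_ne_zero.2 (sinc_pi_mul_div_two_ne_zero ht)
  have hg : ContinuousOn (fun t : ℝ ↦ (t : ℂ) ^ (2 * r) * (1 - (t : ℂ)) ^ (2 * s + 1) /
      ((Real.sinc (Real.pi * t / 2) : ℝ) : ℂ)) (Set.Icc 0 1) :=
    ContinuousOn.div (by fun_prop) hsinc hne
  have hRL := tendsto_integral_mul_cos hg
  have h := hRL.const_sub (∫ t in (0 : ℝ)..1, (t : ℂ) ^ (2 * r) * (1 - (t : ℂ)) ^ (2 * s + 1) *
          ((Real.cos (Real.pi * t / 2) / Real.sinc (Real.pi * t / 2) : ℝ) : ℂ))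
  rw [sub_zero] at h
  refine h.congr fun N ↦ ?_
  rw [← intervalIntegral.integral_sub, ← Finset.mul_sum, ← intervalIntegral.integral_finsetSum,
    ← intervalIntegral.integral_const_mul]
  · refine intervalIntegral.integral_congr fun t ht ↦ ?_
    rw [Set.uIcc_of_le zero_le_one] at ht
    have hk := congrArg (fun x : ℝ ↦ (x : ℂ)) (mul_sum_sin_eq_div_sinc ht N)
    push_cast at hk
    have e (k : ℕ) : ((k + 1 : ℕ) * Real.pi : ℂ) * t = (k + 1) * (Real.pi * t) := by
      push_cast; ring
    simp only [e, eval_mul, eval_pow, eval_X, eval_sub, eval_one, ← Finset.mul_sum]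
    rw [mul_assoc ((N : ℂ) + 1 / 2)]
    push_cast
    linear_combination (-(t : ℂ) ^ (2 * r) * (1 - (t : ℂ)) ^ (2 * s + 1)) * hk
  · intro k _
    exact Continuous.intervalIntegrable ((Polynomial.continuous _ |>.comp continuous_ofReal).mul
      (by fun_prop)) _ _
  · refine ContinuousOn.intervalIntegrable ?_
    rw [Set.uIcc_of_le zero_le_one]
    push_cast
    exact ContinuousOn.mul (by fun_prop) (ContinuousOn.div (by fun_prop) hsinc hne)
  · refine ContinuousOn.intervalIntegrable ?_
    rw [Set.uIcc_of_le zero_le_one]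
    exact hg.mul (by fun_prop)

theorem hasSum_integral_eval_mul_sin (P : ℂ[X]) (h0 : P.eval 0 = 0) (h1 : P.eval 1 = 0) {m : ℕ}
    (hm : P.natDegree < 2 * (m + 1)) :
    HasSum (fun k : ℕ ↦ Real.pi * ∫ t in (0 : ℝ)..1,
        P.eval (t : ℂ) * sin (((k + 1 : ℕ) * Real.pi : ℂ) * t))
      (∑ j ∈ Finset.Icc 1 m, (-1) ^ j * riemannZeta (2 * j + 1) / (Real.pi : ℂ) ^ (2 * j) *
        ((derivative^[2 * j] P).eval 0 +
          (1 - 1 / 4 ^ j) * (derivative^[2 * j] P).eval 1)) := by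
  have hpi : (Real.pi : ℂ) ≠ 0 := ofReal_ne_zero.2 Real.pi_ne_zero
  have hterm (k : ℕ) : Real.pi * ∫ t in (0 : ℝ)..1,
      P.eval (t : ℂ) * sin (((k + 1 : ℕ) * Real.pi : ℂ) * t) =
      ∑ j ∈ Finset.Icc 1 m, (-1) ^ j / (Real.pi : ℂ) ^ (2 * j) *
        ((derivative^[2 * j] P).eval 0 * (1 / (k + 1 : ℂ) ^ (2 * j + 1)) -
          (derivative^[2 * j] P).eval 1 * ((-1) ^ (k + 1) / (k + 1 : ℂ) ^ (2 * j + 1))) := by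
    have hk : (k + 1 : ℂ) ≠ 0 := by exact_mod_cast k.succ_ne_zero
    have hcos : cos ((k + 1 : ℕ) * Real.pi : ℂ) = (-1) ^ (k + 1) := by
      exact_mod_cast congrArg ofReal (Real.cos_nat_mul_pi (k + 1))
    have h := mul_integral_eval_mul_sin_eq_sum P (a := (k + 1 : ℕ) * Real.pi)
      (mul_ne_zero (by exact_mod_cast k.succ_ne_zero) hpi) (sin_nat_mul_pi _) hm
    rw [Finset.range_eq_Ico, Finset.sum_eq_sum_Ico_succ_bot (by omega)] at h
    simp only [mul_zero, Function.iterate_zero, id_eq, h0, h1, zero_mul, sub_zero, zero_add] at h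
    rw [Finset.Ico_add_one_right_eq_Icc, hcos] at h
    rw [← mul_right_inj' hk]
    push_cast at h ⊢
    rw [← mul_assoc, h, Finset.mul_sum]
    refine Finset.sum_congr rfl fun j _ ↦ ?_
    rw [mul_pow]
    field_simp
    ring
  simp_rw [hterm]
  refine hasSum_sum fun j hj ↦ ?_
  have hj1 : 1 < 2 * j + 1 := by have := (Finset.mem_Icc.1 hj).1; omega
  have hz : HasSum (fun k : ℕ ↦ 1 / (k + 1 : ℂ) ^ (2 * j + 1))
      (riemannZeta (2 * j + 1 : ℕ)) := by
    have h := hasSum_one_div_nat_pow_riemannZeta hj1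
    rw [← hasSum_nat_add_iff' 1] at h
    simpa using h
  have h := ((hz.mul_left ((derivative^[2 * j] P).eval 0)).sub
    ((hasSum_neg_one_pow_div_pow hj1).mul_left ((derivative^[2 * j] P).eval 1))).mul_left
    ((-1) ^ j / (Real.pi : ℂ) ^ (2 * j))
  convert! h using 1
  rw [pow_succ 2, pow_mul 2, show (2 : ℂ) ^ 2 = 4 by norm_num]
  push_cast
  field_simp
  ring

theorem stmt_13 (r s : ℕ) :
    ∑' n : ℕ, riemannZeta (2 * n) /
        ((∏ i ∈ Finset.Icc (2 * n + 2 * r + 1) (2 * n + 2 * r + 2 * s + 2), (i : ℂ))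
          * 2 ^ (2 * n)) =
      -(1 / (2 * (Nat.factorial (2 * s + 1) : ℂ))) *
        (∑ k ∈ Finset.Icc 1 (r + s + 1),
            (-1) ^ (k + 1) * (4 ^ k - 1) * riemannZeta (2 * k + 1) * (Nat.factorial (2 * k) : ℂ) /
              (2 * (Real.pi : ℂ)) ^ (2 * k) *
              (chooseInt (2 * r + 1) (2 * k - 2 * s - 1) : ℂ)
          + ∑ k ∈ Finset.Icc 1 (r + s + 1),
              (Nat.factorial (2 * k) : ℂ) * (-1) ^ (k + 1) * riemannZeta (2 * k + 1) /
                (Real.pi : ℂ) ^ (2 * k) *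
                (chooseInt (2 * s + 1) (2 * k - 2 * r - 1) : ℂ)) := by
  have hpi : (Real.pi : ℂ) ≠ 0 := ofReal_ne_zero.2 Real.pi_ne_zero
  set P : ℂ[X] := X ^ (2 * r + 1) * (1 - X) ^ (2 * s + 1) with hP
  have hdeg : P.natDegree < 2 * (r + s + 1 + 1) := by
    have : P.natDegree ≤ (2 * r + 1) + (2 * s + 1) * 1 := by
      rw [hP]
      refine natDegree_mul_le_of_le (natDegree_X_pow_le _) (natDegree_pow_le_of_le _ ?_)
      exact (natDegree_sub_le _ _).trans (by simp)
    omega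
  have hcomp : P.comp (1 - X) = X ^ (2 * s + 1) * (1 - X) ^ (2 * r + 1) := by
    simp [hP, mul_comm]
  rw [tsum_riemannZeta_div_eq_integral, tendsto_nhds_unique (tendsto_sum_integral_mul_sin r s)
    (hasSum_integral_eval_mul_sin P (by simp [hP]) (by simp [hP]) hdeg).tendsto_sum_nat,
    ← Finset.sum_add_distrib]
  congr 1
  refine Finset.sum_congr rfl fun j _ ↦ ?_
  rw [eval_one_iterate_derivative_two_mul, hcomp, eval_zero_iterate_derivative,
    eval_zero_iterate_derivative, hP, coeff_X_pow_mul_one_sub_X_pow_eq_neg_chooseInt,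
    coeff_X_pow_mul_one_sub_X_pow_eq_neg_chooseInt, mul_pow, pow_mul 2,
    show (2 : ℂ) ^ 2 = 4 by norm_num]
  field_simp
  ring
end

section
/- For any nonnegative integers r and s, with K(r,s) := 2^{2r+2s+3}·t({2}^r, 3, {2}^s) and K(d) := 2^{2d}·t({2}^d), one has K(r,s) = 2·∑_{k=1}^{r+s+1} (-1)^{k-1} · [C(2k, 2r+1) + (1 - 1/2^{2k})·C(2k, 2s+1)] · K(r+s-k+1) · ζ(2k+1). -/
/-- The multiple zeta value `ζ(s₁,…,s_l) = ∑_{1 ≤ k₁ < ⋯ < k_l} ∏ 1/kᵢ^{sᵢ}`. -/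
noncomputable def MZV (s : List ℕ) : ℝ :=
  ∑' f : {f : Fin s.length → ℕ+ // StrictMono f},
    ∏ i : Fin s.length, (1 : ℝ) / ((f.1 i : ℕ) : ℝ) ^ s.get i

/-- The multiple t-value `t(s₁,…,s_l) = ∑_{1 ≤ k₁ < ⋯ < k_l} ∏ 1/(2kᵢ-1)^{sᵢ}`. -/
noncomputable def MTV (s : List ℕ) : ℝ :=
  ∑' f : {f : Fin s.length → ℕ+ // StrictMono f},
    ∏ i : Fin s.length, (1 : ℝ) / ((2 * (f.1 i : ℕ) - 1 : ℕ) : ℝ) ^ s.get i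

section

open scoped ENNReal Nat
open Real Filter Topology MeasureTheory intervalIntegral

/-- The multiple `t`-sum over indices exceeding `N`, as an iterated sum. -/
noncomputable def tailSum : List ℕ → ℕ → ℝ≥0∞
  | [], _ => 1
  | a :: w, N => ∑' k : ℕ,
      ENNReal.ofReal (1 / ((2 * (N + k) + 1 : ℕ) : ℝ) ^ a) * tailSum w (N + k + 1)

/-- Prepending a value in `(N, ∞)` to a strictly increasing tuple of larger values. -/
def consTail (l N : ℕ)
    (x : Σ k : ℕ, {g : Fin l → ℕ+ // StrictMono g ∧ ∀ i, N + k + 1 < (g i : ℕ)}) :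
    {f : Fin (l + 1) → ℕ+ // StrictMono f ∧ ∀ i, N < (f i : ℕ)} :=
  ⟨Fin.cons (Nat.succPNat (N + x.1)) x.2.1, by
    refine ⟨?_, ?_⟩
    · rw [Fin.strictMono_iff_lt_succ]
      intro i
      cases l with
      | zero => exact i.elim0
      | succ l =>
        induction i using Fin.cases with
        | zero =>
          have h := x.2.2.2 0
          rw [← PNat.coe_lt_coe]
          simpa using h
        | succ i =>
          have h := x.2.2.1 (Fin.castSucc_lt_succ (i := i))
          simpa using h
    · intro i
      induction i using Fin.cases with
      | zero => simp
      | succ i => have := x.2.2.2 i; simp; omega⟩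

lemma consTail_bijective (l N : ℕ) : Function.Bijective (consTail l N) := by
  constructor
  · rintro ⟨k, g, hg⟩ ⟨k', g', hg'⟩ h
    have h' := congrArg Subtype.val h
    simp only [consTail] at h'
    rw [Fin.cons_inj] at h'
    obtain ⟨h1, h2⟩ := h'
    have h3 := congrArg PNat.val h1
    obtain rfl : k = k' := by
      change N + k + 1 = N + k' + 1 at h3
      omega
    subst h2
    rfl
  · rintro ⟨f, hf, hN⟩
    have h0 := hN 0
    refine ⟨⟨(f 0 : ℕ) - N - 1, Fin.tail f, ?_, ?_⟩, ?_⟩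
    · intro i j hij
      exact hf (Fin.succ_lt_succ_iff.2 hij)
    · intro i
      have h : f 0 < f i.succ := hf (Fin.succ_pos i)
      rw [← PNat.coe_lt_coe] at h
      simp only [Fin.tail]
      omega
    · apply Subtype.ext
      simp only [consTail]
      conv_rhs => rw [← Fin.cons_self_tail f]
      congr 1
      apply PNat.eq
      change N + ((f 0 : ℕ) - N - 1) + 1 = (f 0 : ℕ)
      omega

lemma tsum_strictMono_eq_tailSum (w : List ℕ) (N : ℕ) :
    ∑' f : {f : Fin w.length → ℕ+ // StrictMono f ∧ ∀ i, N < (f i : ℕ)},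
      ENNReal.ofReal (∏ i, (1 : ℝ) / ((2 * (f.1 i : ℕ) - 1 : ℕ) : ℝ) ^ w.get i) =
    tailSum w N := by
  induction w generalizing N with
  | nil =>
    have : Unique {f : Fin ([] : List ℕ).length → ℕ+ // StrictMono f ∧ ∀ i, N < (f i : ℕ)} :=
      { default := ⟨fun i => i.elim0, fun i => i.elim0, fun i => i.elim0⟩
        uniq := fun f => Subtype.ext (funext fun i => i.elim0) }
    rw [tsum_eq_single default (fun f hf => (hf (Subsingleton.elim _ _)).elim)]
    simp [tailSum]
  | cons a w ih =>
    rw [tailSum]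
    refine ((Equiv.ofBijective _ (consTail_bijective w.length N)).tsum_eq _).symm.trans ?_
    rw [ENNReal.tsum_sigma']
    refine tsum_congr fun k => ?_
    rw [← ih, ← ENNReal.tsum_mul_left]
    refine tsum_congr fun g => ?_
    rw [← ENNReal.ofReal_mul (by positivity)]
    congr 1
    refine (Fin.prod_univ_succ _).trans ?_
    congr 1

lemma MTV_eq_tailSum (w : List ℕ) : MTV w = (tailSum w 0).toReal := by
  rw [← tsum_strictMono_eq_tailSum, ENNReal.tsum_toReal_eq (fun _ => ENNReal.ofReal_ne_top), MTV,
    ← (Equiv.subtypeEquivRight (fun f : Fin w.length → ℕ+ =>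
      (⟨fun h => ⟨h, fun i => (f i).pos⟩, fun h => h.1⟩ :
        StrictMono f ↔ StrictMono f ∧ ∀ i, 0 < (f i : ℕ)))).tsum_eq]
  refine tsum_congr fun f => ?_
  rw [ENNReal.toReal_ofReal]
  · rfl
  · positivity

/-- A telescoping evaluation of one layer of `tailSum`. -/
lemma tailSum_cons_of_telescope {a : ℕ} {w : List ℕ} {F G : ℕ → ℝ}
    (hw : ∀ N, tailSum w (N + 1) = ENNReal.ofReal (G (N + 1))) (hG : ∀ N, 0 ≤ G (N + 1))
    (hF : ∀ N, F N = F (N + 1) + 1 / ((2 * N + 1 : ℕ) : ℝ) ^ a * G (N + 1))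
    (hlim : Tendsto F atTop (𝓝 0)) (N : ℕ) :
    tailSum (a :: w) N = ENNReal.ofReal (F N) := by
  have hs : HasSum (fun k => 1 / ((2 * (N + k) + 1 : ℕ) : ℝ) ^ a * G (N + k + 1)) (F N) := by
    rw [hasSum_iff_tendsto_nat_of_nonneg (fun k => mul_nonneg (by positivity) (hG _))]
    have : ∀ n, ∑ k ∈ Finset.range n, 1 / ((2 * (N + k) + 1 : ℕ) : ℝ) ^ a * G (N + k + 1)
        = F N - F (N + n) := by
      intro n
      induction n with
      | zero => simp
      | succ n ih =>
        rw [Finset.sum_range_succ, ih, hF (N + n)]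
        simp only [← add_assoc]
        ring
    simp only [this]
    simpa using tendsto_const_nhds.sub
      (hlim.comp (tendsto_atTop_mono (fun n => Nat.le_add_left n N) tendsto_id))
  rw [tailSum, ← hs.tsum_eq,
    ENNReal.ofReal_tsum_of_nonneg (fun k => mul_nonneg (by positivity) (hG _)) hs.summable]
  refine tsum_congr fun k => ?_
  rw [hw, ← ENNReal.ofReal_mul (by positivity)]

/-- The integral of `(θ - u) ^ p / p! * cos θ ^ m` over `[u, π / 2]`. -/
noncomputable def cosKer (p m : ℕ) (u : ℝ) : ℝ :=
  ∫ θ in u..π / 2, (θ - u) ^ p / p ! * cos θ ^ m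

lemma hasDerivAt_sub_pow_div_factorial (p : ℕ) (u θ : ℝ) :
    HasDerivAt (fun θ => (θ - u) ^ (p + 1) / (p + 1)!) ((θ - u) ^ p / p !) θ := by
  have h := (((hasDerivAt_id θ).sub_const u).pow (p + 1)).div_const ((p + 1)! : ℝ)
  refine h.congr_deriv ?_
  rw [Nat.factorial_succ]
  have : (p ! : ℝ) ≠ 0 := by positivity
  push_cast
  field_simp
  simp

lemma hasDerivAt_cos_pow (m : ℕ) (θ : ℝ) :
    HasDerivAt (fun θ => cos θ ^ (m + 1)) (-(m + 1) * (sin θ * cos θ ^ m)) θ := by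
  refine ((hasDerivAt_cos θ).pow (m + 1)).congr_deriv ?_
  simp
  ring

lemma hasDerivAt_sin_mul_cos_pow (m : ℕ) (θ : ℝ) :
    HasDerivAt (fun θ => -(m + 2) * (sin θ * cos θ ^ (m + 1)))
      ((m + 2) * (m + 1) * cos θ ^ m - (m + 2) ^ 2 * cos θ ^ (m + 2)) θ := by
  refine (((hasDerivAt_sin θ).mul (hasDerivAt_cos_pow m θ)).const_mul (-(m + 2) : ℝ)).congr_deriv ?_
  have := sin_sq_add_cos_sq θ
  linear_combination (m + 2) * (m + 1) * cos θ ^ m * this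

lemma cosKer_recurrence (p m : ℕ) (u : ℝ) :
    (m + 2) ^ 2 * cosKer (p + 2) (m + 2) u + cosKer p (m + 2) u =
      (m + 2) * (m + 1) * cosKer (p + 2) m u := by
  have h := integral_eq_sub_of_hasDerivAt (a := u) (b := π / 2)
    (fun θ _ => ((hasDerivAt_sub_pow_div_factorial (p + 1) u θ).mul
      (hasDerivAt_sin_mul_cos_pow m θ)).sub
      ((hasDerivAt_sub_pow_div_factorial p u θ).mul (hasDerivAt_cos_pow (m + 1) θ)))
    (Continuous.intervalIntegrable (by fun_prop) _ _)
  have e : cosKer p (m + 2) u + (m + 2) ^ 2 * cosKer (p + 2) (m + 2) u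
      - (m + 2) * (m + 1) * cosKer (p + 2) m u = 0 := by
    simp only [cosKer]
    rw [← intervalIntegral.integral_const_mul, ← intervalIntegral.integral_const_mul,
      ← intervalIntegral.integral_add, ← intervalIntegral.integral_sub, ← neg_eq_zero,
      ← intervalIntegral.integral_neg]
    · refine Eq.trans ?_ (h.trans ?_)
      · refine integral_congr fun θ _ => ?_
        push_cast
        ring
      · simp
    all_goals exact Continuous.intervalIntegrable (by fun_prop) _ _
  linarith

lemma cosKer_one_recurrence (m : ℕ) (u : ℝ) :
    (m + 2) ^ 2 * cosKer 1 (m + 2) u + cos u ^ (m + 2) = (m + 2) * (m + 1) * cosKer 1 m u := by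
  have h := integral_eq_sub_of_hasDerivAt (a := u) (b := π / 2)
    (fun θ _ => ((hasDerivAt_sub_pow_div_factorial 0 u θ).mul
      (hasDerivAt_sin_mul_cos_pow m θ)).sub (hasDerivAt_cos_pow (m + 1) θ))
    (Continuous.intervalIntegrable (by fun_prop) _ _)
  have e : (m + 2) * (m + 1) * cosKer 1 m u - (m + 2) ^ 2 * cosKer 1 (m + 2) u
      = cos u ^ (m + 2) := by
    simp only [cosKer]
    rw [← intervalIntegral.integral_const_mul, ← intervalIntegral.integral_const_mul,
      ← intervalIntegral.integral_sub]
    · refine Eq.trans ?_ (h.trans ?_)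
      · refine integral_congr fun θ _ => ?_
        simp
        ring
      · simp
    all_goals exact Continuous.intervalIntegrable (by fun_prop) _ _
  linarith

lemma cosKer_zero_recurrence (m : ℕ) :
    (m + 2) ^ 2 * cosKer 0 (m + 2) 0 = (m + 2) * (m + 1) * cosKer 0 m 0 := by
  have h := integral_eq_sub_of_hasDerivAt (a := 0) (b := π / 2)
    (fun θ _ => hasDerivAt_sin_mul_cos_pow m θ)
    (Continuous.intervalIntegrable (by fun_prop) _ _)
  have e : (m + 2) * (m + 1) * cosKer 0 m 0 - (m + 2) ^ 2 * cosKer 0 (m + 2) 0 = 0 := by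
    simp only [cosKer]
    rw [← intervalIntegral.integral_const_mul, ← intervalIntegral.integral_const_mul,
      ← intervalIntegral.integral_sub]
    · refine Eq.trans ?_ (h.trans ?_)
      · refine integral_congr fun θ _ => ?_
        simp
      · simp
    all_goals exact Continuous.intervalIntegrable (by fun_prop) _ _
  linarith

lemma cosKer_add_cosKer (p : ℕ) (u : ℝ) :
    cosKer (p + 2) 1 u + cosKer p 1 u = (π / 2 - u) ^ (p + 2) / (p + 2)! := by
  have h := integral_eq_sub_of_hasDerivAt (a := u) (b := π / 2)
    (fun θ _ => ((hasDerivAt_sub_pow_div_factorial (p + 1) u θ).mul (hasDerivAt_sin θ)).add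
      ((hasDerivAt_sub_pow_div_factorial p u θ).mul (hasDerivAt_cos θ)))
    (Continuous.intervalIntegrable (by fun_prop) _ _)
  simp only [cosKer]
  rw [← intervalIntegral.integral_add]
  · refine Eq.trans ?_ (h.trans ?_)
    · refine integral_congr fun θ _ => ?_
      simp
      ring
    · simp
  all_goals exact Continuous.intervalIntegrable (by fun_prop) _ _

lemma cosKer_one_one (u : ℝ) : cosKer 1 1 u + cos u = π / 2 - u := by
  have h := integral_eq_sub_of_hasDerivAt (a := u) (b := π / 2)
    (fun θ _ => ((hasDerivAt_sub_pow_div_factorial 0 u θ).mul (hasDerivAt_sin θ)).add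
      (hasDerivAt_cos θ))
    (Continuous.intervalIntegrable (by fun_prop) _ _)
  have e : cosKer 1 1 u = π / 2 - u - cos u := by
    simp only [cosKer]
    refine Eq.trans ?_ (h.trans ?_)
    · refine integral_congr fun θ _ => ?_
      simp
    · simp
  linarith

lemma cosKer_zero_one : cosKer 0 1 0 = 1 := by
  simp [cosKer]

lemma cosKer_zero_pos (m : ℕ) : 0 < cosKer 0 m 0 := by
  have hpi := pi_pos
  refine intervalIntegral_pos_of_pos_on (Continuous.intervalIntegrable (by fun_prop) _ _)
    (fun x hx => ?_) (by linarith)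
  have := cos_pos_of_mem_Ioo ⟨by linarith [hx.1], hx.2⟩
  simp
  positivity

lemma cosKer_nonneg (p m : ℕ) {u : ℝ} (h0 : 0 ≤ u) (h1 : u ≤ π / 2) : 0 ≤ cosKer p m u := by
  refine intervalIntegral.integral_nonneg h1 fun θ hθ => ?_
  have h2 := cos_nonneg_of_mem_Icc ⟨by linarith [hθ.1, pi_pos], hθ.2⟩
  have h3 : 0 ≤ θ - u := by linarith [hθ.1]
  positivity

lemma cosKer_le (p m : ℕ) {u : ℝ} (h0 : 0 ≤ u) (h1 : u ≤ π / 2) :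
    cosKer p m u ≤ (π / 2) ^ (p + 1) * cos u ^ m := by
  have hc := cos_nonneg_of_mem_Icc ⟨by linarith [pi_pos], h1⟩
  calc cosKer p m u ≤ ∫ _ in u..π / 2, (π / 2) ^ p * cos u ^ m := by
        refine integral_mono_on h1 (Continuous.intervalIntegrable (by fun_prop) _ _)
          (Continuous.intervalIntegrable (by fun_prop) _ _) fun θ hθ => ?_
        have h2 := cos_nonneg_of_mem_Icc ⟨by linarith [hθ.1, pi_pos], hθ.2⟩
        have h3 : 0 ≤ θ - u := by linarith [hθ.1]
        have h4 : cos θ ≤ cos u := cos_le_cos_of_nonneg_of_le_pi h0 (by linarith [hθ.2, pi_pos]) hθ.1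
        have h5 : (θ - u) ^ p / p ! ≤ (θ - u) ^ p :=
          div_le_self (by positivity) (by exact_mod_cast Nat.factorial_pos p)
        have h6 : (θ - u) ^ p ≤ (π / 2) ^ p := by
          gcongr
          linarith [hθ.2]
        gcongr
        exact h5.trans h6
    _ = (π / 2 - u) * ((π / 2) ^ p * cos u ^ m) := by simp; ring
    _ ≤ (π / 2) * ((π / 2) ^ p * cos u ^ m) := by
        gcongr
        linarith
    _ = _ := by ring

lemma continuous_cosKer (p m : ℕ) : Continuous (cosKer p m) := by
  have h : cosKer p m = fun u => - ∫ θ in (π / 2)..u, (θ - u) ^ p / p ! * cos θ ^ m := by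
    funext u
    rw [cosKer, integral_symm]
  rw [h]
  refine (continuous_parametric_intervalIntegral_of_continuous
    (f := fun u θ => (θ - u) ^ p / p ! * cos θ ^ m) ?_ continuous_id).neg
  simp only [Function.uncurry_def]
  fun_prop

lemma integral_pow_mul_sin_mul_cos_pow (q m : ℕ) :
    ∫ u in (0)..π / 2, u ^ (q + 1) / (q + 1)! * (sin u * cos u ^ m) =
      1 / (m + 1) * cosKer q (m + 1) 0 := by
  have h := integral_eq_sub_of_hasDerivAt (a := 0) (b := π / 2)
    (fun θ _ => (hasDerivAt_sub_pow_div_factorial q 0 θ).mul (hasDerivAt_cos_pow m θ))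
    (Continuous.intervalIntegrable (by fun_prop) _ _)
  have e : cosKer q (m + 1) 0 - (m + 1) *
      ∫ u in (0)..π / 2, u ^ (q + 1) / (q + 1)! * (sin u * cos u ^ m) = 0 := by
    simp only [cosKer]
    rw [← intervalIntegral.integral_const_mul, ← intervalIntegral.integral_sub]
    · refine Eq.trans ?_ (h.trans ?_)
      · refine integral_congr fun θ _ => ?_
        simp
        ring
      · simp
    all_goals exact Continuous.intervalIntegrable (by fun_prop) _ _
  rw [one_div_mul_eq_div, eq_div_iff (by positivity)]
  linarith

lemma cosKer_add_two_le (q m : ℕ) :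
    cosKer (q + 2) (m + 1) 0 ≤ 1 / (m + 1) * cosKer q (m + 1) 0 := by
  rw [← integral_pow_mul_sin_mul_cos_pow]
  refine integral_mono_on (by positivity) (Continuous.intervalIntegrable (by fun_prop) _ _)
    (Continuous.intervalIntegrable (by fun_prop) _ _) fun θ hθ => ?_
  have hc := cos_nonneg_of_mem_Icc ⟨by linarith [hθ.1, pi_pos], hθ.2⟩
  have h0 := hθ.1
  have ht : θ * cos θ ≤ sin θ := by
    rcases hθ.2.lt_or_eq with h | h
    · have hc' := cos_pos_of_mem_Ioo ⟨by linarith [pi_pos], h⟩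
      have := le_tan h0 h
      rwa [tan_eq_sin_div_cos, le_div_iff₀ hc'] at this
    · simp [h]
  have hf : θ ^ (q + 1) / (q + 2)! ≤ θ ^ (q + 1) / (q + 1)! := by
    gcongr
    omega
  calc (θ - 0) ^ (q + 2) / (q + 2)! * cos θ ^ (m + 1)
      = θ ^ (q + 1) / (q + 2)! * (θ * cos θ * cos θ ^ m) := by ring
    _ ≤ θ ^ (q + 1) / (q + 1)! * (sin θ * cos θ ^ m) := by gcongr

/-- The kernel `cosKer p (2 * N - 1)`, normalised by `cosKer 0 (2 * N - 1) 0`, with its limiting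
value at `N = 0`. -/
noncomputable def normKer (p : ℕ) : ℕ → ℝ → ℝ
  | 0, u => (π / 2 - u) ^ p / p !
  | N + 1, u => cosKer p (2 * N + 1) u / cosKer 0 (2 * N + 1) 0

lemma normKer_add_two (p N : ℕ) (u : ℝ) :
    normKer (p + 2) N u =
      normKer (p + 2) (N + 1) u + 1 / ((2 * N + 1 : ℕ) : ℝ) ^ 2 * normKer p (N + 1) u := by
  cases N with
  | zero => simp [normKer, cosKer_zero_one, cosKer_add_cosKer]
  | succ N =>
    have h1 := cosKer_recurrence p (2 * N + 1) u
    have h2 := cosKer_zero_recurrence (2 * N + 1)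
    have h3 := (cosKer_zero_pos (2 * N + 1)).ne'
    have h4 := (cosKer_zero_pos (2 * N + 1 + 2)).ne'
    simp only [normKer, show 2 * (N + 1) + 1 = 2 * N + 1 + 2 by ring]
    push_cast at *
    have h5 : (2 * N + 1 + 2 : ℝ) ≠ 0 := by positivity
    field_simp
    linear_combination cosKer (p + 2) (2 * N + 1) u * h2 - cosKer 0 (2 * N + 1) 0 * h1

lemma normKer_one (N : ℕ) (u : ℝ) :
    normKer 1 N u = normKer 1 (N + 1) u +
      1 / ((2 * N + 1 : ℕ) : ℝ) ^ 2 * (cos u ^ (2 * N + 1) / cosKer 0 (2 * N + 1) 0) := by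
  cases N with
  | zero => simp [normKer, cosKer_zero_one, cosKer_one_one]
  | succ N =>
    have h1 := cosKer_one_recurrence (2 * N + 1) u
    have h2 := cosKer_zero_recurrence (2 * N + 1)
    have h3 := (cosKer_zero_pos (2 * N + 1)).ne'
    have h4 := (cosKer_zero_pos (2 * N + 1 + 2)).ne'
    simp only [normKer, show 2 * (N + 1) + 1 = 2 * N + 1 + 2 by ring]
    push_cast at *
    have h5 : (2 * N + 1 + 2 : ℝ) ≠ 0 := by positivity
    field_simp
    linear_combination cosKer 1 (2 * N + 1) u * h2 - cosKer 0 (2 * N + 1) 0 * h1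

lemma normKer_zero (N : ℕ) : normKer 0 N 0 = 1 := by
  cases N with
  | zero => simp [normKer]
  | succ N => exact div_self (cosKer_zero_pos _).ne'

lemma normKer_nonneg (p N : ℕ) {u : ℝ} (h0 : 0 ≤ u) (h1 : u ≤ π / 2) : 0 ≤ normKer p N u := by
  cases N with
  | zero =>
    have : 0 ≤ π / 2 - u := by linarith
    simp only [normKer]
    positivity
  | succ N => exact div_nonneg (cosKer_nonneg _ _ h0 h1) (cosKer_zero_pos _).le

lemma normKer_add_two_le (q N : ℕ) :
    normKer (q + 2) (N + 1) 0 ≤ 1 / (2 * N + 1) * normKer q (N + 1) 0 := by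
  have h := cosKer_add_two_le q (2 * N)
  simp only [normKer]
  rw [← mul_div_assoc]
  push_cast at h
  gcongr
  exact (cosKer_zero_pos _).le

lemma normKer_le_one (s N : ℕ) : normKer (2 * s) (N + 1) 0 ≤ 1 := by
  induction s with
  | zero => exact (normKer_zero _).le
  | succ s ih =>
    refine (normKer_add_two_le _ _).trans (mul_le_one₀ ?_ ?_ ih)
    · rw [div_le_one (by positivity)]
      linarith [Nat.cast_nonneg (α := ℝ) N]
    · exact normKer_nonneg _ _ le_rfl (by positivity)

lemma tendsto_of_le_inv {F : ℕ → ℝ} (C : ℝ) (h0 : ∀ N, 0 ≤ F (N + 1))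
    (h : ∀ N, F (N + 1) ≤ C * (1 / (2 * N + 1))) : Tendsto F atTop (𝓝 0) := by
  rw [← tendsto_add_atTop_iff_nat 1]
  refine squeeze_zero h0 h ?_
  have h1 : Tendsto (fun N : ℕ => (2 * N + 1 : ℝ)) atTop atTop :=
    tendsto_atTop_add_const_right _ _
      (tendsto_natCast_atTop_atTop.const_mul_atTop (by norm_num))
  simpa using h1.inv_tendsto_atTop.const_mul C

lemma tailSum_replicate_two (s N : ℕ) :
    tailSum (List.replicate s 2) N = ENNReal.ofReal (normKer (2 * s) N 0) := by
  induction s generalizing N with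
  | zero => simp [tailSum, normKer_zero]
  | succ s ih =>
    rw [List.replicate_succ]
    have hn : ∀ q N, 0 ≤ normKer q N 0 := fun q N => normKer_nonneg _ _ le_rfl (by positivity)
    refine tailSum_cons_of_telescope (F := fun N => normKer (2 * (s + 1)) N 0)
      (G := fun N => normKer (2 * s) N 0) (fun N => ih _) (fun N => hn _ _)
      (fun N => normKer_add_two _ _ _) (tendsto_of_le_inv 1 (fun N => hn _ _) fun N => ?_) N
    refine (normKer_add_two_le _ _).trans ?_
    rw [one_mul]
    exact mul_le_of_le_one_right (by positivity) (normKer_le_one _ _)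

/-- The integral of `u ^ (2s + 1) / (2s + 1)! * tan u` against a normalised kernel. -/
noncomputable def tanInt (r s N : ℕ) : ℝ :=
  ∫ u in (0)..π / 2, u ^ (2 * s + 1) / (2 * s + 1)! * tan u * normKer (2 * r + 1) N u

lemma intervalIntegrable_mul_tan_mul {f Q : ℝ → ℝ} (C : ℝ) (hf : Continuous f) (hQ : Continuous Q)
    (h : ∀ u ∈ Set.Icc 0 (π / 2), |Q u| ≤ C * cos u) :
    IntervalIntegrable (fun u => f u * tan u * Q u) volume 0 (π / 2) := by
  have hm : Measurable (fun u => f u * tan u * Q u) := by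
    have : Measurable tan := by
      have : tan = fun x => sin x / cos x := funext tan_eq_sin_div_cos
      rw [this]
      fun_prop
    fun_prop
  refine IntervalIntegrable.mono_fun' (g := fun u => |f u| * C)
    (Continuous.intervalIntegrable (by fun_prop) _ _) hm.aestronglyMeasurable ?_
  filter_upwards [ae_restrict_mem measurableSet_uIoc] with u hu
  rw [Set.uIoc_of_le (by positivity)] at hu
  have hQu := h u ⟨hu.1.le, hu.2⟩
  rw [norm_mul, norm_mul, mul_assoc]
  gcongr
  · exact le_rfl
  simp only [norm_eq_abs]
  rcases hu.2.lt_or_eq with h2 | h2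
  · have hc := cos_pos_of_mem_Ioo ⟨by linarith [pi_pos, hu.1], h2⟩
    have hC : 0 ≤ C := by
      by_contra hC
      have := mul_neg_of_neg_of_pos (not_le.1 hC) hc
      linarith [abs_nonneg (Q u)]
    rw [tan_eq_sin_div_cos, abs_div, abs_of_pos hc, div_mul_eq_mul_div, div_le_iff₀ hc]
    calc |sin u| * |Q u| ≤ 1 * |Q u| := by
          gcongr
          exact abs_sin_le_one u
      _ ≤ C * cos u := by rwa [one_mul]
  · have hC : 0 ≤ C := by
      have := h 0 ⟨le_rfl, by positivity⟩
      rw [cos_zero, mul_one] at this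
      exact (abs_nonneg _).trans this
    simpa [h2] using hC

lemma continuous_normKer (p N : ℕ) : Continuous (normKer p N) := by
  cases N with
  | zero =>
    change Continuous fun u => (π / 2 - u) ^ p / (p ! : ℝ)
    fun_prop
  | succ N => exact (continuous_cosKer _ _).div_const _

lemma pi_div_two_sub_le {u : ℝ} (h0 : 0 ≤ u) (h1 : u ≤ π / 2) : π / 2 - u ≤ π / 2 * cos u := by
  have h := mul_le_sin (x := π / 2 - u) (by linarith) (by linarith)
  rw [sin_pi_div_two_sub] at h
  have hp := pi_pos
  calc π / 2 - u = π / 2 * (2 / π * (π / 2 - u)) := by field_simp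
    _ ≤ _ := by gcongr

lemma normKer_bound (p N : ℕ) :
    ∃ C, ∀ u ∈ Set.Icc 0 (π / 2), |normKer (p + 1) N u| ≤ C * cos u := by
  cases N with
  | zero =>
    refine ⟨(π / 2) ^ p * (π / 2), fun u hu => ?_⟩
    rw [abs_of_nonneg (normKer_nonneg _ _ hu.1 hu.2)]
    have h0 : 0 ≤ π / 2 - u := by linarith [hu.2]
    calc normKer (p + 1) 0 u ≤ (π / 2 - u) ^ (p + 1) :=
          div_le_self (by positivity) (by exact_mod_cast Nat.factorial_pos _)
      _ = (π / 2 - u) ^ p * (π / 2 - u) := pow_succ _ _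
      _ ≤ (π / 2) ^ p * (π / 2 * cos u) := by
          gcongr
          · linarith [hu.1]
          · exact pi_div_two_sub_le hu.1 hu.2
      _ = _ := by ring
  | succ N =>
    refine ⟨(π / 2) ^ (p + 1 + 1) / cosKer 0 (2 * N + 1) 0, fun u hu => ?_⟩
    rw [abs_of_nonneg (normKer_nonneg _ _ hu.1 hu.2)]
    have hc := cos_nonneg_of_mem_Icc ⟨by linarith [hu.1, pi_pos], hu.2⟩
    simp only [normKer]
    rw [div_mul_eq_mul_div]
    gcongr
    · exact (cosKer_zero_pos _).le
    · refine (cosKer_le _ _ hu.1 hu.2).trans ?_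
      gcongr
      exact pow_le_of_le_one hc (cos_le_one u) (by omega)

lemma intervalIntegrable_tanInt (r s N : ℕ) :
    IntervalIntegrable (fun u => u ^ (2 * s + 1) / (2 * s + 1)! * tan u * normKer (2 * r + 1) N u)
      volume 0 (π / 2) := by
  obtain ⟨C, hC⟩ := normKer_bound (2 * r) N
  exact intervalIntegrable_mul_tan_mul C (by fun_prop) (continuous_normKer _ _) hC

lemma intervalIntegrable_tan_mul_cos_pow (s N : ℕ) :
    IntervalIntegrable (fun u => u ^ (2 * s + 1) / (2 * s + 1)! * tan u * cos u ^ (2 * N + 1))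
      volume 0 (π / 2) := by
  refine intervalIntegrable_mul_tan_mul 1 (by fun_prop) (by fun_prop) fun u hu => ?_
  have hc := cos_nonneg_of_mem_Icc ⟨by linarith [hu.1, pi_pos], hu.2⟩
  rw [abs_of_nonneg (by positivity), one_mul]
  exact pow_le_of_le_one hc (cos_le_one u) (by omega)

lemma integral_tan_mul_cos_pow (s N : ℕ) :
    ∫ u in (0)..π / 2, u ^ (2 * s + 1) / (2 * s + 1)! * tan u * cos u ^ (2 * N + 1) =
      1 / (2 * N + 1) * cosKer (2 * s) (2 * N + 1) 0 := by
  have h := integral_pow_mul_sin_mul_cos_pow (2 * s) (2 * N)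
  push_cast at h
  rw [← h]
  refine integral_congr_Ioo_of_le (by positivity) fun u hu => ?_
  have hc := cos_pos_of_mem_Ioo ⟨by linarith [pi_pos, hu.1], hu.2⟩
  simp only [tan_eq_sin_div_cos]
  field_simp
  ring

lemma tanInt_succ (r s N : ℕ) :
    tanInt (r + 1) s N = tanInt (r + 1) s (N + 1) +
      1 / ((2 * N + 1 : ℕ) : ℝ) ^ 2 * tanInt r s (N + 1) := by
  simp only [tanInt]
  rw [← intervalIntegral.integral_const_mul, ← intervalIntegral.integral_add
    (intervalIntegrable_tanInt _ _ _) ((intervalIntegrable_tanInt _ _ _).const_mul _)]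
  refine integral_congr fun u _ => ?_
  have h := normKer_add_two (2 * r + 1) N u
  simp only [show 2 * (r + 1) + 1 = 2 * r + 1 + 2 by ring, h]
  ring

lemma tanInt_zero (s N : ℕ) :
    tanInt 0 s N = tanInt 0 s (N + 1) +
      1 / ((2 * N + 1 : ℕ) : ℝ) ^ 3 * normKer (2 * s) (N + 1) 0 := by
  have e : 1 / ((2 * N + 1 : ℕ) : ℝ) ^ 3 * normKer (2 * s) (N + 1) 0 =
      1 / ((2 * N + 1 : ℕ) : ℝ) ^ 2 / cosKer 0 (2 * N + 1) 0 *
      ∫ u in (0)..π / 2, u ^ (2 * s + 1) / (2 * s + 1)! * tan u * cos u ^ (2 * N + 1) := by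
    rw [integral_tan_mul_cos_pow, normKer]
    have := (cosKer_zero_pos (2 * N + 1)).ne'
    push_cast
    field_simp
  rw [e]
  simp only [tanInt]
  rw [← intervalIntegral.integral_const_mul, ← intervalIntegral.integral_add
    (intervalIntegrable_tanInt _ _ _) ((intervalIntegrable_tan_mul_cos_pow _ _).const_mul _)]
  refine integral_congr fun u _ => ?_
  simp only [mul_zero, zero_add, normKer_one N u]
  ring

lemma tanInt_nonneg (r s N : ℕ) : 0 ≤ tanInt r s N := by
  refine intervalIntegral.integral_nonneg (by positivity) fun u hu => ?_
  have h0 := hu.1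
  have := tan_nonneg_of_nonneg_of_le_pi_div_two hu.1 hu.2
  have := normKer_nonneg (2 * r + 1) N hu.1 hu.2
  positivity

lemma tanInt_succ_le (r s N : ℕ) :
    tanInt r s (N + 1) ≤ (π / 2) ^ (2 * r + 1 + 1) * (1 / (2 * N + 1)) := by
  have hW := cosKer_zero_pos (2 * N + 1)
  calc tanInt r s (N + 1) ≤ ∫ u in (0)..π / 2, (π / 2) ^ (2 * r + 1 + 1) / cosKer 0 (2 * N + 1) 0 *
        (u ^ (2 * s + 1) / (2 * s + 1)! * tan u * cos u ^ (2 * N + 1)) := by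
        refine integral_mono_on (by positivity) (intervalIntegrable_tanInt _ _ _)
          ((intervalIntegrable_tan_mul_cos_pow _ _).const_mul _) fun u hu => ?_
        have h0 := hu.1
        have ht := tan_nonneg_of_nonneg_of_le_pi_div_two hu.1 hu.2
        have h := cosKer_le (2 * r + 1) (2 * N + 1) hu.1 hu.2
        simp only [normKer]
        calc _ ≤ u ^ (2 * s + 1) / (2 * s + 1)! * tan u *
              ((π / 2) ^ (2 * r + 1 + 1) * cos u ^ (2 * N + 1) / cosKer 0 (2 * N + 1) 0) := by
              gcongr
          _ = _ := by ring
    _ = (π / 2) ^ (2 * r + 1 + 1) * (1 / (2 * N + 1) * normKer (2 * s) (N + 1) 0) := by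
        rw [intervalIntegral.integral_const_mul, integral_tan_mul_cos_pow, normKer]
        ring
    _ ≤ _ := by
        gcongr
        exact mul_le_of_le_one_right (by positivity) (normKer_le_one _ _)

lemma tailSum_two_three_two (r s N : ℕ) :
    tailSum (List.replicate r 2 ++ 3 :: List.replicate s 2) N = ENNReal.ofReal (tanInt r s N) := by
  have hlim : ∀ r, Tendsto (tanInt r s) atTop (𝓝 0) := fun r =>
    tendsto_of_le_inv _ (fun N => tanInt_nonneg _ _ _) (tanInt_succ_le r s)
  induction r generalizing N with
  | zero =>
    exact tailSum_cons_of_telescope (F := tanInt 0 s) (G := fun N => normKer (2 * s) N 0)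
      (fun N => tailSum_replicate_two _ _)
      (fun N => normKer_nonneg _ _ le_rfl (by positivity)) (tanInt_zero s) (hlim 0) N
  | succ r ih =>
    exact tailSum_cons_of_telescope (F := tanInt (r + 1) s) (G := tanInt r s)
      (fun N => ih _) (fun N => tanInt_nonneg _ _ _) (tanInt_succ r s) (hlim _) N

lemma MTV_replicate_two (d : ℕ) : MTV (List.replicate d 2) = (π / 2) ^ (2 * d) / (2 * d)! := by
  rw [MTV_eq_tailSum, tailSum_replicate_two, ENNReal.toReal_ofReal]
  · simp [normKer]
  · exact normKer_nonneg _ _ le_rfl (by positivity)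

lemma MTV_two_three_two (r s : ℕ) :
    MTV (List.replicate r 2 ++ 3 :: List.replicate s 2) =
      ∫ u in (0)..π / 2, u ^ (2 * s + 1) / (2 * s + 1)! * tan u *
        ((π / 2 - u) ^ (2 * r + 1) / (2 * r + 1)!) := by
  rw [MTV_eq_tailSum, tailSum_two_three_two, ENNReal.toReal_ofReal (tanInt_nonneg _ _ _)]
  rfl

lemma tendsto_integral_mul_sin {f : ℝ → ℝ} (hf : IntervalIntegrable f volume 0 (π / 2)) :
    Tendsto (fun M : ℕ => ∫ u in (0)..π / 2, f u * sin ((2 * M + 1) * u)) atTop (𝓝 0) := by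
  have hle : (0 : ℝ) ≤ π / 2 := by positivity
  have hw : Tendsto (fun M : ℕ => -((2 * M + 1 : ℝ) / (2 * π))) atTop (cocompact ℝ) := by
    have h1 : Tendsto (fun M : ℕ => (2 * M + 1 : ℝ) / (2 * π)) atTop atTop :=
      (tendsto_atTop_add_const_right _ _
        (tendsto_natCast_atTop_atTop.const_mul_atTop (by norm_num))).atTop_div_const (by positivity)
    exact (tendsto_neg_atTop_atBot.comp h1).mono_right atBot_le_cocompact
  have h := (Real.tendsto_integral_exp_smul_cocompact
    ((Set.Ioc 0 (π / 2)).indicator fun u => (f u : ℂ))).comp hw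
  have him := (Complex.continuous_im.tendsto 0).comp h
  rw [Complex.zero_im] at him
  refine him.congr fun M => ?_
  simp only [Function.comp_apply]
  have e : ∀ v : ℝ, (fourierChar (-(v * -((2 * M + 1 : ℝ) / (2 * π)))) •
      (Set.Ioc 0 (π / 2)).indicator (fun u => (f u : ℂ)) v) =
      (Set.Ioc 0 (π / 2)).indicator
        (fun u => Complex.exp (((2 * M + 1) * u : ℝ) * Complex.I) * (f u : ℂ)) v := by
    intro v
    by_cases hv : v ∈ Set.Ioc 0 (π / 2)
    · rw [Set.indicator_of_mem hv, Set.indicator_of_mem hv, Circle.smul_def, Real.fourierChar_apply,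
        smul_eq_mul]
      congr 4
      field_simp
    · rw [Set.indicator_of_notMem hv, Set.indicator_of_notMem hv, smul_zero]
  simp only [e]
  rw [MeasureTheory.integral_indicator measurableSet_Ioc, integral_of_le hle]
  have hi : Integrable (fun u => Complex.exp (((2 * M + 1) * u : ℝ) * Complex.I) * (f u : ℂ))
      (volume.restrict (Set.Ioc 0 (π / 2))) := by
    refine Integrable.bdd_mul (c := 1) hf.1.ofReal (by fun_prop) ?_
    filter_upwards with u
    rw [Complex.norm_exp_ofReal_mul_I]
  have := integral_im hi
  simp only [RCLike.im_to_complex] at this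
  rw [← this]
  refine MeasureTheory.integral_congr_ae ?_
  filter_upwards with u
  rw [Complex.im_mul_ofReal, Complex.exp_ofReal_mul_I_im, mul_comm]

lemma two_mul_cos_mul_sum_sin (u : ℝ) (M : ℕ) :
    2 * cos u * ∑ m ∈ Finset.range M, (-1) ^ m * sin (2 * (m + 1) * u) =
      sin u - (-1) ^ M * sin ((2 * M + 1) * u) := by
  induction M with
  | zero => simp
  | succ M ih =>
    rw [Finset.sum_range_succ, mul_add, ih]
    have h1 : (2 * ((M + 1 : ℕ) : ℝ) + 1) * u = 2 * (M + 1) * u + u := by push_cast; ring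
    have h2 : (2 * (M : ℝ) + 1) * u = 2 * (M + 1) * u - u := by ring
    rw [h1, h2, sin_add, sin_sub, pow_succ]
    ring

lemma tendsto_sum_integral_sin {P : ℝ → ℝ} (hP : Continuous P)
    (hi : IntervalIntegrable (fun u => P u / cos u) volume 0 (π / 2)) :
    Tendsto (fun M : ℕ => ∑ m ∈ Finset.range M,
        2 * (-1) ^ m * ∫ u in (0)..π / 2, P u * sin (2 * (m + 1) * u))
      atTop (𝓝 (∫ u in (0)..π / 2, P u * tan u)) := by
  have key : ∀ M : ℕ, ∑ m ∈ Finset.range M,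
        2 * (-1) ^ m * ∫ u in (0)..π / 2, P u * sin (2 * (m + 1) * u) =
      (∫ u in (0)..π / 2, P u * tan u) -
        (-1) ^ M * ∫ u in (0)..π / 2, P u / cos u * sin ((2 * M + 1) * u) := by
    intro M
    have hi1 : IntervalIntegrable (fun u => P u * tan u) volume 0 (π / 2) := by
      have := hi.mul_continuousOn (g := sin) (by fun_prop)
      refine this.congr (fun u _ => ?_)
      simp only [tan_eq_sin_div_cos]
      ring
    have hi2 : IntervalIntegrable (fun u => (-1) ^ M * (P u / cos u * sin ((2 * M + 1) * u)))
        volume 0 (π / 2) := (hi.mul_continuousOn (by fun_prop)).const_mul _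
    simp only [← intervalIntegral.integral_const_mul]
    rw [← intervalIntegral.integral_finsetSum
      (fun m _ => Continuous.intervalIntegrable (by fun_prop) _ _),
      ← intervalIntegral.integral_sub hi1 hi2]
    refine integral_congr_Ioo_of_le (by positivity) fun u hu => ?_
    have hc := (cos_pos_of_mem_Ioo ⟨by linarith [pi_pos, hu.1], hu.2⟩).ne'
    have h := two_mul_cos_mul_sum_sin u M
    have e : ∑ m ∈ Finset.range M, 2 * (-1) ^ m * (P u * sin (2 * (m + 1) * u)) =
        P u / cos u * (2 * cos u * ∑ m ∈ Finset.range M, (-1) ^ m * sin (2 * (m + 1) * u)) := by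
      rw [Finset.mul_sum, Finset.mul_sum]
      refine Finset.sum_congr rfl fun m _ => ?_
      field_simp
    simp only [e, h, tan_eq_sin_div_cos]
    ring
  simp only [key]
  have h0 : Tendsto (fun M : ℕ => (-1 : ℝ) ^ M *
      ∫ u in (0)..π / 2, P u / cos u * sin ((2 * M + 1) * u)) atTop (𝓝 0) := by
    rw [tendsto_zero_iff_norm_tendsto_zero]
    simpa using (tendsto_integral_mul_sin hi).norm
  simpa using tendsto_const_nhds.sub h0

open Polynomial in
lemma integral_polynomial_mul_sin_step (P : ℝ[X]) (n : ℕ) (hn : n ≠ 0) :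
    ∫ u in (0)..π / 2, P.eval u * sin (2 * n * u) =
      (P.eval 0 - (-1) ^ n * P.eval (π / 2)) / (2 * n) -
        1 / (2 * n) ^ 2 * ∫ u in (0)..π / 2, (derivative (derivative P)).eval u * sin (2 * n * u) := by
  have hn' : (n : ℝ) ≠ 0 := by exact_mod_cast hn
  have hs : ∀ u : ℝ, HasDerivAt (fun u => sin (2 * n * u)) (cos (2 * n * u) * (2 * n)) u :=
    fun u => ((hasDerivAt_id u).const_mul (2 * n : ℝ)).sin.congr_deriv (by simp)
  have hc : ∀ u : ℝ, HasDerivAt (fun u => cos (2 * n * u)) (-sin (2 * n * u) * (2 * n)) u :=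
    fun u => ((hasDerivAt_id u).const_mul (2 * n : ℝ)).cos.congr_deriv (by simp)
  have h := integral_eq_sub_of_hasDerivAt (a := 0) (b := π / 2)
    (fun u _ => (((derivative P).hasDerivAt u).mul (hs u)).sub
      (((P.hasDerivAt u).mul (hc u)).mul_const (2 * n : ℝ)))
    (Continuous.intervalIntegrable (by fun_prop) _ _)
  have e1 : (2 * n * (π / 2) : ℝ) = n * π := by ring
  have h1 : (∫ u in (0)..π / 2, (derivative (derivative P)).eval u * sin (2 * n * u)) +
      (2 * n) ^ 2 * (∫ u in (0)..π / 2, P.eval u * sin (2 * n * u)) =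
      (2 * n) * (P.eval 0 - (-1) ^ n * P.eval (π / 2)) := by
    rw [← intervalIntegral.integral_const_mul, ← intervalIntegral.integral_add]
    · refine Eq.trans ?_ (h.trans ?_)
      · refine integral_congr fun u _ => ?_
        ring
      · simp [e1, sin_nat_mul_pi, cos_nat_mul_pi]
        ring
    all_goals exact Continuous.intervalIntegrable (by fun_prop) _ _
  field_simp
  linarith

open Polynomial in
lemma integral_polynomial_mul_sin (d : ℕ) (P : ℝ[X]) (hP : derivative^[2 * d] P = 0) (n : ℕ)
    (hn : n ≠ 0) :
    ∫ u in (0)..π / 2, P.eval u * sin (2 * n * u) =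
      ∑ j ∈ Finset.range d, (-1) ^ j * ((derivative^[2 * j] P).eval 0 -
        (-1) ^ n * (derivative^[2 * j] P).eval (π / 2)) / (2 * n) ^ (2 * j + 1) := by
  have hn' : (n : ℝ) ≠ 0 := by exact_mod_cast hn
  induction d generalizing P with
  | zero =>
    have : P = 0 := hP
    simp [this]
  | succ d ih =>
    rw [integral_polynomial_mul_sin_step P n hn, ih (derivative (derivative P)) hP,
      Finset.sum_range_succ']
    simp only [← Function.iterate_succ_apply]
    rw [Finset.mul_sum, sub_eq_add_neg, add_comm, ← Finset.sum_neg_distrib]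
    congr 1
    · refine Finset.sum_congr rfl fun j _ => ?_
      simp only [show 2 * (j + 1) = (2 * j).succ.succ from rfl]
      rw [show (2 * j).succ.succ + 1 = 2 * j + 1 + 2 from rfl, pow_add _ (2 * j + 1) 2, pow_succ _ j]
      field_simp
    · simp

lemma hasSum_alternating {k : ℕ} (hk : 1 < k) :
    HasSum (fun m : ℕ => (-1 : ℝ) ^ m / (m + 1) ^ k)
      ((1 - 2 / 2 ^ k) * ∑' n : ℕ, 1 / (n : ℝ) ^ k) := by
  have hs : Summable (fun n : ℕ => 1 / (n : ℝ) ^ k) := Real.summable_one_div_nat_pow.2 hk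
  have he : HasSum (fun n : ℕ => 1 / ((2 * n : ℕ) : ℝ) ^ k)
      (1 / 2 ^ k * ∑' n : ℕ, 1 / (n : ℝ) ^ k) := by
    refine (hs.hasSum.mul_left (1 / 2 ^ k)).congr_fun fun n => ?_
    push_cast
    rw [mul_pow]
    field_simp
  obtain ⟨o, ho⟩ : Summable (fun n : ℕ => 1 / ((2 * n + 1 : ℕ) : ℝ) ^ k) :=
    hs.comp_injective (i := fun n => 2 * n + 1) (fun a b h => by simpa using h)
  have ha := (HasSum.even_add_odd (f := fun n : ℕ => 1 / (n : ℝ) ^ k) he ho).unique hs.hasSum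
  have hv := HasSum.even_add_odd (f := fun n : ℕ => (-1 : ℝ) ^ (n + 1) / (n : ℝ) ^ k)
    (he.neg.congr_fun fun n => by simp [pow_succ, neg_div])
    (ho.congr_fun fun n => by simp [pow_succ])
  have hv' := (hasSum_nat_add_iff' 1).2 hv
  have hval : -(1 / 2 ^ k * ∑' n : ℕ, 1 / (n : ℝ) ^ k) + o -
      ∑ i ∈ Finset.range 1, (-1 : ℝ) ^ (i + 1) / (i : ℝ) ^ k =
      (1 - 2 / 2 ^ k) * ∑' n : ℕ, 1 / (n : ℝ) ^ k := by
    rw [Finset.sum_range_one, Nat.cast_zero, zero_pow (by omega), div_zero]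
    linear_combination ha
  rw [hval] at hv'
  exact hv'.congr_fun fun m => by simp [pow_succ]

open Polynomial in
/-- The polynomial `u ^ (2s + 1) * (π / 2 - u) ^ (2r + 1) / ((2r + 1)! * (2s + 1)!)`. -/
noncomputable def tanPoly (r s : ℕ) : ℝ[X] :=
  C (1 / ((2 * r + 1)! * (2 * s + 1)! : ℝ)) * (X ^ (2 * s + 1) * (C (π / 2) - X) ^ (2 * r + 1))

lemma factorial_div_mul_choose {a b k d : ℕ} (hb : b ≤ k) (hk : k + d = a + b) :
    (k ! : ℝ) * (1 / (a ! * b !) * a.choose (k - b)) = k.choose b / d ! := by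
  obtain ⟨i, rfl⟩ := Nat.exists_eq_add_of_le hb
  obtain rfl : a = i + d := by omega
  have h1 := Nat.choose_mul_factorial_mul_factorial (n := b + i) (k := b) (by omega)
  have h2 := Nat.choose_mul_factorial_mul_factorial (n := i + d) (k := i) (by omega)
  rw [Nat.add_sub_cancel_left] at h1 h2 ⊢
  rw [← h1, ← h2]
  push_cast
  have h3 : ((i + d).choose i : ℝ) ≠ 0 := by
    exact_mod_cast (Nat.choose_pos (by omega)).ne'
  field_simp

open Polynomial in
lemma eval_iterate_derivative_eq_taylor_coeff (P : ℝ[X]) (k : ℕ) (c : ℝ) :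
    (derivative^[k] P).eval c = k ! * (taylor c P).coeff k := by
  rw [taylor_coeff, ← factorial_smul_hasseDeriv]
  simp

open Polynomial in
lemma eval_zero_iterate_derivative_tanPoly {r s j d : ℕ} (h : j + d = r + s + 1) :
    (derivative^[2 * j] (tanPoly r s)).eval 0 =
      -((2 * j).choose (2 * s + 1) * ((π / 2) ^ (2 * d) / (2 * d)!)) := by
  rw [eval_iterate_derivative_eq_taylor_coeff, taylor_zero, tanPoly, coeff_C_mul, coeff_X_pow_mul']
  split_ifs with hk
  · have e : (C (π / 2) - X : ℝ[X]) ^ (2 * r + 1) = -(X + C (-(π / 2))) ^ (2 * r + 1) := by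
      rw [C_neg, ← sub_eq_add_neg, ← neg_sub X, Odd.neg_pow ⟨r, rfl⟩]
    rw [e, coeff_neg, coeff_X_add_C_pow, show 2 * r + 1 - (2 * j - (2 * s + 1)) = 2 * d by omega,
      (even_two_mul d).neg_pow]
    have := factorial_div_mul_choose (a := 2 * r + 1) (d := 2 * d) hk (by omega)
    linear_combination (-(π / 2) ^ (2 * d)) * this
  · rw [Nat.choose_eq_zero_of_lt (by omega)]
    simp

open Polynomial in
lemma eval_pi_div_two_iterate_derivative_tanPoly {r s j d : ℕ} (h : j + d = r + s + 1) :
    (derivative^[2 * j] (tanPoly r s)).eval (π / 2) =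
      -((2 * j).choose (2 * r + 1) * ((π / 2) ^ (2 * d) / (2 * d)!)) := by
  have e : taylor (π / 2) (tanPoly r s) = C (1 / ((2 * r + 1)! * (2 * s + 1)! : ℝ)) *
      (X ^ (2 * r + 1) * -(X + C (π / 2)) ^ (2 * s + 1)) := by
    simp only [tanPoly, taylor_mul, taylor_C, taylor_pow, taylor_X, map_sub]
    rw [show C (π / 2) - (X + C (π / 2)) = -(X : ℝ[X]) by ring, Odd.neg_pow ⟨r, rfl⟩]
    ring
  rw [eval_iterate_derivative_eq_taylor_coeff, e, coeff_C_mul, coeff_X_pow_mul']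
  split_ifs with hk
  · rw [coeff_neg, coeff_X_add_C_pow, show 2 * s + 1 - (2 * j - (2 * r + 1)) = 2 * d by omega]
    have := factorial_div_mul_choose (a := 2 * s + 1) (d := 2 * d) hk (by omega)
    linear_combination (-(π / 2) ^ (2 * d)) * this
  · rw [Nat.choose_eq_zero_of_lt (by omega)]
    simp

open Polynomial in
lemma iterate_derivative_tanPoly_eq_zero (r s : ℕ) :
    derivative^[2 * (r + s + 2)] (tanPoly r s) = 0 := by
  refine iterate_derivative_eq_zero ?_
  have h : (tanPoly r s).natDegree ≤ 0 + ((2 * s + 1) * 1 + (2 * r + 1) * 1) := by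
    unfold tanPoly
    refine natDegree_mul_le_of_le (natDegree_C _).le
      (natDegree_mul_le_of_le (natDegree_pow_le_of_le _ natDegree_X_le)
        (natDegree_pow_le_of_le _ ?_))
    exact (natDegree_sub_le _ _).trans (by simp)
  omega

lemma intervalIntegrable_tanPoly_div_cos (r s : ℕ) :
    IntervalIntegrable (fun u => (tanPoly r s).eval u / cos u) volume 0 (π / 2) := by
  set f : ℝ → ℝ := fun u => 1 / ((2 * r + 1)! * (2 * s + 1)! : ℝ) *
    (u ^ (2 * s + 1) * (π / 2 - u) ^ (2 * r)) with hf
  have hfc : Continuous f := by fun_prop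
  have e : ∀ u, (tanPoly r s).eval u = f u * (π / 2 - u) := by
    intro u
    simp [tanPoly, hf]
    ring
  refine IntervalIntegrable.mono_fun' (g := fun u => |f u| * (π / 2))
    (Continuous.intervalIntegrable (by fun_prop) _ _)
    (Measurable.aestronglyMeasurable (by fun_prop)) ?_
  filter_upwards [ae_restrict_mem measurableSet_uIoc] with u hu
  rw [Set.uIoc_of_le (by positivity)] at hu
  have hc := cos_nonneg_of_mem_Icc ⟨by linarith [hu.1, pi_pos], hu.2⟩
  rw [e, mul_div_assoc, norm_mul, norm_eq_abs, norm_eq_abs]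
  gcongr
  have h0 : 0 ≤ π / 2 - u := by linarith [hu.2]
  rw [abs_of_nonneg (by positivity)]
  exact div_le_of_le_mul₀ hc (by positivity) (pi_div_two_sub_le hu.1.le hu.2)

lemma tendsto_sum_one_div {k : ℕ} (hk : 1 < k) :
    Tendsto (fun M => ∑ m ∈ Finset.range M, 1 / ((m : ℝ) + 1) ^ k) atTop
      (𝓝 (∑' n : ℕ, 1 / (n : ℝ) ^ k)) := by
  have h := (hasSum_nat_add_iff' 1).2 (Real.summable_one_div_nat_pow.2 hk).hasSum
  rw [Finset.sum_range_one, Nat.cast_zero, zero_pow (by omega), div_zero, sub_zero] at h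
  simpa using h.tendsto_sum_nat

lemma MTV_two_three_two_eq_sum (r s : ℕ) :
    MTV (List.replicate r 2 ++ 3 :: List.replicate s 2) =
      ∑ i ∈ Finset.range (r + s + 1), (-1) ^ i * (1 / 2 ^ (2 * (i + 1))) *
        ((2 * (i + 1)).choose (2 * r + 1) +
          (1 - 1 / 2 ^ (2 * (i + 1))) * (2 * (i + 1)).choose (2 * s + 1)) *
        MTV (List.replicate (r + s - i) 2) * ∑' n : ℕ, 1 / (n : ℝ) ^ (2 * (i + 1) + 1) := by
  have h1 := tendsto_sum_integral_sin (tanPoly r s).continuous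
    (intervalIntegrable_tanPoly_div_cos r s)
  have hint : MTV (List.replicate r 2 ++ 3 :: List.replicate s 2) =
      ∫ u in (0)..π / 2, (tanPoly r s).eval u * tan u := by
    rw [MTV_two_three_two]
    refine integral_congr fun u _ => ?_
    simp [tanPoly]
    field_simp
  rw [hint]
  refine tendsto_nhds_unique h1 ?_
  have hterm : ∀ m : ℕ, 2 * (-1 : ℝ) ^ m *
      ∫ u in (0)..π / 2, (tanPoly r s).eval u * sin (2 * (m + 1) * u) =
      ∑ i ∈ Finset.range (r + s + 1), (-1) ^ i * (1 / 2 ^ (2 * (i + 1))) *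
        MTV (List.replicate (r + s - i) 2) *
        ((2 * (i + 1)).choose (2 * r + 1) * (1 / ((m : ℝ) + 1) ^ (2 * (i + 1) + 1)) +
         (2 * (i + 1)).choose (2 * s + 1) * ((-1) ^ m / ((m : ℝ) + 1) ^ (2 * (i + 1) + 1))) := by
    intro m
    have h := integral_polynomial_mul_sin _ _ (iterate_derivative_tanPoly_eq_zero r s) (m + 1)
      (by omega)
    push_cast at h
    have h0 : (tanPoly r s).eval 0 = 0 := by simp [tanPoly]
    have h2 : (tanPoly r s).eval (π / 2) = 0 := by simp [tanPoly]
    rw [h, Finset.sum_range_succ', mul_zero, Function.iterate_zero, id, h0, h2]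
    simp only [mul_zero, sub_zero, zero_div, add_zero]
    rw [Finset.mul_sum]
    refine Finset.sum_congr rfl fun i hi => ?_
    have hd : i + 1 + (r + s - i) = r + s + 1 := by
      have := Finset.mem_range.1 hi
      omega
    have hq : (-1 : ℝ) ^ m * (-1) ^ m = 1 := by rw [← mul_pow]; simp
    have hm : (m : ℝ) + 1 ≠ 0 := by positivity
    rw [eval_zero_iterate_derivative_tanPoly hd, eval_pi_div_two_iterate_derivative_tanPoly hd,
      MTV_replicate_two, mul_pow 2 ((m : ℝ) + 1), pow_succ 2 (2 * (i + 1)), pow_succ _ m,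
      pow_succ _ i]
    generalize (π / 2) ^ (2 * (r + s - i)) / (2 * (r + s - i))! = t
    field_simp
    linear_combination (t * (2 * (i + 1)).choose (2 * r + 1)) * hq
  simp only [hterm]
  have hlim : ∀ i : ℕ, Tendsto (fun M => ∑ m ∈ Finset.range M,
      (-1) ^ i * (1 / 2 ^ (2 * (i + 1))) * MTV (List.replicate (r + s - i) 2) *
        ((2 * (i + 1)).choose (2 * r + 1) * (1 / ((m : ℝ) + 1) ^ (2 * (i + 1) + 1)) +
         (2 * (i + 1)).choose (2 * s + 1) * ((-1) ^ m / ((m : ℝ) + 1) ^ (2 * (i + 1) + 1))))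
      atTop (𝓝 ((-1) ^ i * (1 / 2 ^ (2 * (i + 1))) *
        ((2 * (i + 1)).choose (2 * r + 1) +
          (1 - 1 / 2 ^ (2 * (i + 1))) * (2 * (i + 1)).choose (2 * s + 1)) *
        MTV (List.replicate (r + s - i) 2) * ∑' n : ℕ, 1 / (n : ℝ) ^ (2 * (i + 1) + 1))) := by
    intro i
    have hk : 1 < 2 * (i + 1) + 1 := by omega
    simp only [← Finset.mul_sum, Finset.sum_add_distrib]
    have ha := (tendsto_sum_one_div hk).const_mul ((2 * (i + 1)).choose (2 * r + 1) : ℝ)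
    have hb := (hasSum_alternating hk).tendsto_sum_nat.const_mul
      ((2 * (i + 1)).choose (2 * s + 1) : ℝ)
    convert (ha.add hb).const_mul
      ((-1) ^ i * (1 / 2 ^ (2 * (i + 1))) * MTV (List.replicate (r + s - i) 2)) using 2
    rw [pow_succ _ (2 * (i + 1))]
    field_simp
  simp only [Finset.sum_comm (s := Finset.range _) (t := Finset.range (r + s + 1))]
  exact tendsto_finsetSum _ fun i _ => hlim i

lemma riemannZeta_odd_eq_ofReal (i : ℕ) :
    riemannZeta (2 * ((i + 1 : ℕ) : ℂ) + 1) =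
      ((∑' n : ℕ, 1 / (n : ℝ) ^ (2 * (i + 1) + 1) : ℝ) : ℂ) := by
  have h := zeta_nat_eq_tsum_of_gt_one (k := 2 * (i + 1) + 1) (by omega)
  push_cast at h ⊢
  exact h

end

theorem stmt_14 (r s : ℕ)
    (K : ℝ) (hK : K = 2 ^ (2 * r + 2 * s + 3) * MTV (List.replicate r 2 ++ 3 :: List.replicate s 2))
    (Kd : ℕ → ℝ) (hKd : ∀ d, Kd d = 2 ^ (2 * d) * MTV (List.replicate d 2)) :
    (K : ℂ) =
      2 * ∑ k ∈ Finset.Icc 1 (r + s + 1),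
        (-1) ^ (k - 1) *
          ((Nat.choose (2 * k) (2 * r + 1) : ℂ) +
            (1 - 1 / 2 ^ (2 * k)) * (Nat.choose (2 * k) (2 * s + 1) : ℂ)) *
          (Kd (r + s + 1 - k) : ℂ) * riemannZeta (2 * k + 1) := by
  rw [show Finset.Icc 1 (r + s + 1) = Finset.Ico 1 (r + s + 1 + 1) from rfl,
    Finset.sum_Ico_eq_sum_range, Nat.add_sub_cancel, hK, MTV_two_three_two_eq_sum]
  push_cast
  rw [Finset.mul_sum, Finset.mul_sum]
  refine Finset.sum_congr rfl fun i hi => ?_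
  have hi' := Finset.mem_range.1 hi
  have hz := riemannZeta_odd_eq_ofReal i
  have hp : (2 : ℂ) ^ (2 * r + 2 * s + 3) =
      2 * 2 ^ (2 * (r + s - i)) * 2 ^ (2 * (i + 1)) := by
    rw [mul_assoc, ← pow_add, ← pow_succ']
    congr 1
    omega
  have hd : r + s + 1 - (1 + i) = r + s - i := by omega
  rw [add_comm 1 (i : ℂ), hd, add_comm 1 i, Nat.add_sub_cancel, hKd, hp]
  push_cast at hz ⊢
  rw [hz]
  field_simp
end
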